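/- For every class C of cohesion networks, all nonempty coalitions C1, C2 ⊆ Agt, and every formula φ ∈ L, the formula Help_{C1→C2}φ → φ is provable in ⊢_C (successful assistance between coalitions implies its result). -/

import Mathlib

/- A coalition (group) is a nonempty finite set of agents. -/
abbrev Coal (Agt : Type) [DecidableEq Agt] := {s : Finset Agt // s.Nonempty}

/- A (candidate) cohesion network: a set Γ of coalitions together with an
   edge relation ⇒ between coalitions.  (Nonemptiness of the coalitions,
   i.e. ∅ ∉ Γ, is built into the type `Coal`.) -/
abbrev Net (Agt : Type) [DecidableEq Agt] :=
  Finset (Coal Agt) × Finset (Coal Agt × Coal Agt)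

/- `Admissible G N` says that N = (Γ, ⇒) is a cohesion network for G:
   Γ ⊆ 𝒫(G), ⇒ ⊆ Γ × Γ, G ∉ Γ, ∅ ∉ Γ (automatic), and every member of G
   occurs in some edge of ⇒. -/
def Admissible {Agt : Type} [DecidableEq Agt] (G : Finset Agt) (N : Net Agt) : Prop :=
  (∀ C ∈ N.1, C.1 ⊆ G ∧ C.1 ≠ G) ∧
  (∀ e ∈ N.2, e.1 ∈ N.1 ∧ e.2 ∈ N.1) ∧
  (∀ i ∈ G, ∃ e ∈ N.2, i ∈ e.1.1 ∪ e.2.1)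

/- A class of cohesion networks assigns to every nondegenerate group G a set
   C(G) ⊆ C0(G) of admissible cohesion networks for G. -/
def CohClass {Agt : Type} [DecidableEq Agt] (C : Finset Agt → Finset (Net Agt)) : Prop :=
  ∀ G : Finset Agt, 2 ≤ G.card → ∀ N ∈ C G, Admissible G N

/- The language L: atoms, ⊤, ¬, ∧, and modalities E_G, A_G, Help_{C1→C2}
   for nonempty coalitions. -/
inductive LForm (Agt Atm : Type) [DecidableEq Agt] : Type
  | atom : Atm → LForm Agt Atm
  | top  : LForm Agt Atm
  | neg  : LForm Agt Atm → LForm Agt Atm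
  | and  : LForm Agt Atm → LForm Agt Atm → LForm Agt Atm
  | E    : Coal Agt → LForm Agt Atm → LForm Agt Atm
  | A    : Coal Agt → LForm Agt Atm → LForm Agt Atm
  | help : Coal Agt → Coal Agt → LForm Agt Atm → LForm Agt Atm

namespace LForm

variable {Agt Atm : Type} [DecidableEq Agt]

def imp (φ ψ : LForm Agt Atm) : LForm Agt Atm := neg (and φ (neg ψ))

def iff (φ ψ : LForm Agt Atm) : LForm Agt Atm := and (imp φ ψ) (imp ψ φ)

def or (φ ψ : LForm Agt Atm) : LForm Agt Atm := neg (and (neg φ) (neg ψ))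

def bot : LForm Agt Atm := neg top

def bigAnd (l : List (LForm Agt Atm)) : LForm Agt Atm := l.foldr and top

def bigOr (l : List (LForm Agt Atm)) : LForm Agt Atm := l.foldr or bot

end LForm

/- The singleton coalition {i}. -/
def single {Agt : Type} [DecidableEq Agt] (i : Agt) : Coal Agt :=
  ⟨{i}, Finset.singleton_nonempty i⟩

/- Classical propositional tautologies over L: true under every valuation of
   formulas respecting ⊤, ¬ and ∧ (modal subformulas are treated as atoms). -/
def LTaut {Agt Atm : Type} [DecidableEq Agt] (φ : LForm Agt Atm) : Prop :=
  ∀ v : LForm Agt Atm → Prop,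
    v LForm.top →
    (∀ ψ, v (LForm.neg ψ) ↔ ¬ v ψ) →
    (∀ ψ χ, v (LForm.and ψ χ) ↔ (v ψ ∧ v χ)) →
    v φ

/- The proof system ⊢_C, for a class C of cohesion networks. -/
inductive CProv {Agt Atm : Type} [DecidableEq Agt]
    (C : Finset Agt → Finset (Net Agt)) : LForm Agt Atm → Prop
  | taut {φ} : LTaut φ → CProv C φ
  | notaut (i : Agt) : CProv C (LForm.neg (LForm.E (single i) LForm.top))
  | success (i : Agt) (φ : LForm Agt Atm) : CProv C ((LForm.E (single i) φ).imp φ)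
  | help_ax (C1 C2 : Coal Agt) (φ : LForm Agt Atm) :
      CProv C ((LForm.help C1 C2 φ).iff
        ((LForm.E C1 ((LForm.A C2 φ).imp φ)).and (LForm.A C2 φ)))
  | cohagen (G : Coal Agt) (hG : 2 ≤ G.1.card) (φ : LForm Agt Atm) :
      CProv C ((LForm.E G φ).iff
        (LForm.bigOr ((C G.1).toList.map (fun N =>
          LForm.bigAnd (N.2.toList.map (fun e => LForm.help e.1 e.2 φ))))))
  | attind (G : Coal Agt) (hG : 2 ≤ G.1.card) (φ : LForm Agt Atm) :
      CProv C ((LForm.A G φ).iff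
        (LForm.bigAnd (G.1.toList.map (fun i => LForm.A (single i) φ))))
  | mp {φ ψ} : CProv C (φ.imp ψ) → CProv C φ → CProv C ψ
  | ree (i : Agt) {φ ψ} : CProv C (φ.iff ψ) →
      CProv C ((LForm.E (single i) φ).iff (LForm.E (single i) ψ))
  | rea (i : Agt) {φ ψ} : CProv C (φ.iff ψ) →
      CProv C ((LForm.A (single i) φ).iff (LForm.A (single i) ψ))

namespace CProv

variable {Agt Atm : Type} [DecidableEq Agt] {C : Finset Agt → Finset (Net Agt)}

theorem imp_trans {φ ψ χ : LForm Agt Atm} (h₁ : CProv C (φ.imp ψ)) (h₂ : CProv C (ψ.imp χ)) :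
    CProv C (φ.imp χ) := by
  have t : CProv C ((φ.imp ψ).imp ((ψ.imp χ).imp (φ.imp χ))) := by
    refine taut fun v _ hn ha => ?_
    simp only [LForm.imp, hn, ha]
    tauto
  exact mp (mp t h₁) h₂

theorem imp_of_iff {φ ψ : LForm Agt Atm} (h : CProv C (φ.iff ψ)) : CProv C (φ.imp ψ) := by
  have t : CProv C ((φ.iff ψ).imp (φ.imp ψ)) := by
    refine taut fun v _ hn ha => ?_
    simp only [LForm.iff, LForm.imp, hn, ha]
    tauto
  exact mp t h

theorem bigAnd_imp_of_mem {l : List (LForm Agt Atm)} {φ : LForm Agt Atm} (h : φ ∈ l) :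
    CProv C ((LForm.bigAnd l).imp φ) := by
  refine taut fun v _ hn ha => ?_
  simp only [LForm.imp, hn, ha, not_and, not_not]
  intro hv
  induction l with
  | nil => simp at h
  | cons ψ l ih =>
    have hv' := (ha ψ (LForm.bigAnd l)).1 hv
    rcases List.mem_cons.1 h with rfl | h
    · exact hv'.1
    · exact ih h hv'.2

theorem bigOr_imp {l : List (LForm Agt Atm)} {φ : LForm Agt Atm}
    (h : ∀ ψ ∈ l, CProv C (ψ.imp φ)) : CProv C ((LForm.bigOr l).imp φ) := by
  induction l with
  | nil =>
    refine taut fun v ht hn ha => ?_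
    simp only [LForm.bigOr, LForm.bot, LForm.imp, List.foldr_nil, hn, ha]
    tauto
  | cons ψ l ih =>
    have t : CProv C ((ψ.imp φ).imp (((LForm.bigOr l).imp φ).imp
        ((LForm.bigOr (ψ :: l)).imp φ))) := by
      refine taut fun v _ hn ha => ?_
      simp only [LForm.bigOr, LForm.or, LForm.imp, List.foldr_cons, hn, ha]
      tauto
    exact mp (mp t (h ψ List.mem_cons_self)) (ih fun χ hχ => h χ (List.mem_cons_of_mem ψ hχ))

theorem help_imp_of_E_imp {C1 C2 : Coal Agt} {φ : LForm Agt Atm}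
    (h : CProv C ((LForm.E C1 ((LForm.A C2 φ).imp φ)).imp ((LForm.A C2 φ).imp φ))) :
    CProv C ((LForm.help C1 C2 φ).imp φ) := by
  refine imp_trans (imp_of_iff (help_ax C1 C2 φ)) (mp ?_ h)
  refine taut fun v _ hn ha => ?_
  simp only [LForm.imp, hn, ha]
  tauto

theorem E_imp_self (hC : CohClass C) (G : Coal Agt) (φ : LForm Agt Atm) :
    CProv C ((LForm.E G φ).imp φ) := by
  induction hn : G.1.card using Nat.strong_induction_on generalizing G φ with
  | _ n ih =>
    subst hn
    by_cases hG : 2 ≤ G.1.card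
    · refine imp_trans (imp_of_iff (cohagen G hG φ)) (bigOr_imp fun ψ hψ => ?_)
      obtain ⟨N, hN, rfl⟩ := List.mem_map.1 hψ
      obtain ⟨hsub, hedge, hcover⟩ := hC G.1 hG N (Finset.mem_toList.1 hN)
      obtain ⟨i, hi⟩ := G.2
      obtain ⟨e, he, -⟩ := hcover i hi
      have hlt : e.1.1.card < G.1.card :=
        Finset.card_lt_card ((hsub e.1 (hedge e he).1).1.ssubset_of_ne (hsub e.1 (hedge e he).1).2)
      exact imp_trans
        (bigAnd_imp_of_mem (List.mem_map.2 ⟨e, Finset.mem_toList.2 he, rfl⟩))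
        (help_imp_of_E_imp (ih _ hlt e.1 _ rfl))
    · have hpos := G.2.card_pos
      obtain ⟨i, hi⟩ := Finset.card_eq_one.1 (show G.1.card = 1 by omega)
      obtain rfl : G = single i := Subtype.ext hi
      exact success i φ

end CProv

/-- For every class C of cohesion networks, all nonempty
    coalitions C1, C2 and every formula φ, ⊢_C Help_{C1→C2}φ → φ. -/
theorem cprov_help_success {Agt Atm : Type} [Fintype Agt] [DecidableEq Agt]
    (C : Finset Agt → Finset (Net Agt)) (hC : CohClass C)
    (C1 C2 : Coal Agt) (φ : LForm Agt Atm) :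
    CProv C ((LForm.help C1 C2 φ).imp φ) := by
  exact CProv.help_imp_of_E_imp (CProv.E_imp_self hC C1 _)
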